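/- arXiv:0907.1958 — 2 statements merged into one kernel-verified Lean document; each statement's English description precedes it below -/
import Mathlib

section
/- Let G' be a finite simple graph and γ an automorphism of G' with γ³ = id and γ(u) ≠ u for every vertex u, and let v₁, v₂ be distinct vertices of G'. Suppose that |E(G')| = 2|V(G')| − 6, that every subgraph H of G' with |V(H)| ≥ 2 satisfies |E(H)| ≤ 2|V(H)| − 3, and that every subgraph H of G' with v₁, v₂ ∈ V(H) satisfies |E(H)| ≤ 2|V(H)| − 4. Then the graph G̃ obtained from G' by adding the three edges {v₁,v₂}, {γ(v₁),γ(v₂)}, and {γ²(v₁),γ²(v₂)} satisfies the Laman conditions. -/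
open Matrix

noncomputable section

namespace C3Laman

variable {V : Type*} [Fintype V] [DecidableEq V]

/-- The Laman conditions: `|E(G)| = 2|V(G)| - 3`, and `|E(H)| ≤ 2|V(H)| - 3` for every
subgraph `H` of `G` with at least two vertices. -/
def Laman (G : SimpleGraph V) : Prop :=
  (G.edgeSet.ncard : ℤ) = 2 * Fintype.card V - 3 ∧
  ∀ H : G.Subgraph, 2 ≤ H.verts.ncard →
    (H.edgeSet.ncard : ℤ) ≤ 2 * (H.verts.ncard : ℤ) - 3

open Classical in
/-- Edges of `G` induced on `X`. -/
def indE {V : Type*} [Fintype V] (G : SimpleGraph V) (X : Finset V) : Finset (Sym2 V) :=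
  Finset.univ.filter (fun e => e ∈ G.edgeSet ∧ ∀ v ∈ e, v ∈ X)

theorem mem_indE {V : Type*} [Fintype V] (G : SimpleGraph V) (X : Finset V) (e : Sym2 V) :
    e ∈ indE G X ↔ e ∈ G.edgeSet ∧ ∀ v ∈ e, v ∈ X := by
  simp [indE]

/-- `2|X| - i(X)`. -/
def ff {V : Type*} [Fintype V] (G : SimpleGraph V) (X : Finset V) : ℤ :=
  2 * (X.card : ℤ) - ((indE G X).card : ℤ)

theorem three_dvd_card {α : Type*} [DecidableEq α] (g : α → α) (h3 : ∀ x, g (g (g x)) = x)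
    (S : Finset α) (hS : ∀ x ∈ S, g x ∈ S) (hf : ∀ x ∈ S, g x ≠ x) : 3 ∣ S.card := by
  let p : Function.End S := fun x => ⟨g x, hS _ x.2⟩
  have hp : p ^ 3 ^ 1 = 1 := by
    funext x
    exact Subtype.ext (h3 x)
  have : Fact (Nat.Prime 3) := ⟨by norm_num⟩
  have := Equiv.Perm.card_fixedPoints_modEq hp
  have h0 : Fintype.card (Function.fixedPoints p) = 0 := by
    rw [Fintype.card_eq_zero_iff]
    refine ⟨fun x => hf x.1.1 x.1.2 ?_⟩
    have := x.2
    exact congrArg Subtype.val this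
  rw [h0] at this
  simpa using (Nat.modEq_zero_iff_dvd.mp this)

theorem ff_submod {V : Type*} [Fintype V] [DecidableEq V] (G : SimpleGraph V) (X Y : Finset V) :
    ff G (X ∪ Y) + ff G (X ∩ Y) ≤ ff G X + ff G Y := by
  have h1 := Finset.card_union_add_card_inter X Y
  have h2 := Finset.card_union_add_card_inter (indE G X) (indE G Y)
  have h3 : (indE G X ∪ indE G Y).card ≤ (indE G (X ∪ Y)).card := by
    apply Finset.card_le_card
    intro e
    simp only [Finset.mem_union, mem_indE]
    rintro (h | h)
    · exact ⟨h.1, fun v hv => Or.inl (h.2 v hv)⟩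
    · exact ⟨h.1, fun v hv => Or.inr (h.2 v hv)⟩
  have h4 : indE G X ∩ indE G Y = indE G (X ∩ Y) := by
    ext e
    simp only [Finset.mem_inter, mem_indE]
    constructor
    · rintro ⟨h, h'⟩
      exact ⟨h.1, fun v hv => ⟨h.2 v hv, h'.2 v hv⟩⟩
    · rintro ⟨h, h'⟩
      exact ⟨⟨h, fun v hv => (h' v hv).1⟩, ⟨h, fun v hv => (h' v hv).2⟩⟩
  rw [h4] at h2
  unfold ff
  omega

theorem map_mem_edge {V : Type*} (G : SimpleGraph V) (γ : G ≃g G) (e : Sym2 V)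
    (he : e ∈ G.edgeSet) : Sym2.map γ e ∈ G.edgeSet := by
  induction e with
  | _ a b => exact γ.map_adj_iff.mpr he

theorem ff_image {V : Type*} [Fintype V] [DecidableEq V] (G : SimpleGraph V) (γ : G ≃g G)
    (hγ3 : ∀ u, γ (γ (γ u)) = u) (X : Finset V) :
    ff G (X.image γ) = ff G X := by
  have key : ∀ X : Finset V, ff G (X.image γ) ≤ ff G X := by
    intro X
    have h1 : (X.image γ).card = X.card := Finset.card_image_of_injective _ γ.injective
    have h2 : ((indE G X).image (Sym2.map γ)).card = (indE G X).card :=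
      Finset.card_image_of_injective _ (Sym2.map.injective γ.injective)
    have h3 : ((indE G X).image (Sym2.map γ)).card ≤ (indE G (X.image γ)).card := by
      apply Finset.card_le_card
      intro e he
      obtain ⟨e, he', rfl⟩ := Finset.mem_image.mp he
      clear he
      have he := he'
      rw [mem_indE] at he ⊢
      refine ⟨map_mem_edge G γ e he.1, fun v hv => ?_⟩
      obtain ⟨w, hw, rfl⟩ := Sym2.mem_map.mp hv
      exact Finset.mem_image_of_mem _ (he.2 w hw)
    unfold ff
    omega
  have h := key X
  have h' := key (X.image γ)
  have h'' := key ((X.image γ).image γ)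
  have : ((X.image γ).image γ).image γ = X := by
    ext x
    simp [Finset.image_image, Function.comp_def, hγ3]
  rw [this] at h''
  omega

theorem ff_dvd {V : Type*} [Fintype V] [DecidableEq V] (G : SimpleGraph V) (γ : G ≃g G)
    (hγ3 : ∀ u, γ (γ (γ u)) = u) (hfree : ∀ u, γ u ≠ u) (X : Finset V)
    (hX : ∀ x ∈ X, γ x ∈ X) : 3 ∣ ff G X := by
  have h1 := three_dvd_card γ hγ3 X hX (fun x _ => hfree x)
  have h2 : 3 ∣ (indE G X).card := by
    apply three_dvd_card (Sym2.map γ)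
    · intro e
      induction e with
      | _ a b => simp [hγ3]
    · intro e he
      rw [mem_indE] at he ⊢
      refine ⟨map_mem_edge G γ e he.1, fun v hv => ?_⟩
      obtain ⟨w, hw, rfl⟩ := Sym2.mem_map.mp hv
      exact hX _ (he.2 w hw)
    · intro e _
      induction e with
      | _ a b =>
        intro h
        rw [Sym2.map_mk, Sym2.eq_iff] at h
        rcases h with h | h
        · exact hfree _ h.1
        · have h3 := hγ3 a
          rw [h.1, h.2] at h3
          exact hfree a h3
  unfold ff
  omega

/-- One improvement step for invariant families. -/
theorem ff_step {V : Type*} [Fintype V] [DecidableEq V] (G : SimpleGraph V) (γ : G ≃g G)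
    (hγ3 : ∀ u, γ (γ (γ u)) = u) (hfree : ∀ u, γ u ≠ u) (T : Finset V)
    (hT : T.image γ = T) (c : ℤ) (hc : ¬ 3 ∣ c) (h : ∀ X, T ⊆ X → c ≤ ff G X) :
    ∀ X, T ⊆ X → c + 1 ≤ ff G X := by
  intro X hX
  by_contra hlt
  have hXc : ff G X = c := by have := h X hX; omega
  have step : ∀ Y, T ⊆ Y → ff G Y = c →
      T ⊆ Y ∪ Y.image γ ∧ ff G (Y ∪ Y.image γ) = c := by
    intro Y hY hYc
    have hTγ : T ⊆ Y.image γ := by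
      rw [← hT]; exact Finset.image_subset_image hY
    have hU : T ⊆ Y ∪ Y.image γ := hY.trans Finset.subset_union_left
    have h1 := h _ hU
    have h2 := h _ (Finset.subset_inter hY hTγ)
    have h3 := ff_submod G Y (Y.image γ)
    rw [ff_image G γ hγ3] at h3
    exact ⟨hU, by omega⟩
  obtain ⟨hY, hYc⟩ := step X hX hXc
  obtain ⟨hZ, hZc⟩ := step _ hY hYc
  apply hc
  rw [← hZc]
  apply ff_dvd G γ hγ3 hfree
  intro x
  simp only [Finset.mem_union, Finset.mem_image]
  grind

theorem indE_subgraph {V : Type*} [Fintype V] (G : SimpleGraph V) (X : Finset V) :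
    ∃ H : G.Subgraph, H.verts = X ∧ H.edgeSet = indE G X := by
  refine ⟨(⊤ : G.Subgraph).induce X, rfl, ?_⟩
  ext e
  induction e with
  | _ a b =>
    simp [mem_indE]
    tauto

/-- Let `G'` be a graph with an automorphism `γ` satisfying `γ³ = id` and fixing no
vertex, and let `v₁ ≠ v₂` be vertices of `G'`.  Suppose `|E(G')| = 2|V(G')| - 6`, every
subgraph `H` of `G'` with at least two vertices satisfies `|E(H)| ≤ 2|V(H)| - 3`, and
every subgraph `H` of `G'` containing `v₁` and `v₂` satisfies `|E(H)| ≤ 2|V(H)| - 4`.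
Then the graph obtained from `G'` by adding the three edges `{v₁, v₂}`,
`{γ v₁, γ v₂}`, `{γ² v₁, γ² v₂}` satisfies the Laman conditions. -/
theorem c3_add_three_edges_laman {V : Type*} [Fintype V] [DecidableEq V]
    (G' : SimpleGraph V) (γ : G' ≃g G')
    (hγ3 : ∀ u, γ (γ (γ u)) = u) (hfree : ∀ u, γ u ≠ u)
    (v₁ v₂ : V) (h12 : v₁ ≠ v₂)
    (hcount : (G'.edgeSet.ncard : ℤ) = 2 * Fintype.card V - 6)
    (hsub : ∀ H : G'.Subgraph, 2 ≤ H.verts.ncard →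
      (H.edgeSet.ncard : ℤ) ≤ 2 * (H.verts.ncard : ℤ) - 3)
    (hsub12 : ∀ H : G'.Subgraph, v₁ ∈ H.verts → v₂ ∈ H.verts →
      (H.edgeSet.ncard : ℤ) ≤ 2 * (H.verts.ncard : ℤ) - 4) :
    Laman (G' ⊔ SimpleGraph.fromEdgeSet
      {s(v₁, v₂), s(γ v₁, γ v₂), s(γ (γ v₁), γ (γ v₂))}) := by
  set e0 := s(v₁, v₂) with he0
  set e1 := s(γ v₁, γ v₂) with he1
  set e2 := s(γ (γ v₁), γ (γ v₂)) with he2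
  have hk0 : ∀ X : Finset V, 2 ≤ X.card → 3 ≤ ff G' X := by
    intro X hX
    obtain ⟨H, h1, h2⟩ := indE_subgraph G' X
    have := hsub H (by rw [h1, Set.ncard_coe_finset]; exact hX)
    rw [h1, h2, Set.ncard_coe_finset, Set.ncard_coe_finset] at this
    unfold ff
    omega
  have hk1 : ∀ X : Finset V, v₁ ∈ X → v₂ ∈ X → 4 ≤ ff G' X := by
    intro X hX hX'
    obtain ⟨H, h1, h2⟩ := indE_subgraph G' X
    have := hsub12 H (by rw [h1]; exact hX) (by rw [h1]; exact hX')
    rw [h1, h2, Set.ncard_coe_finset, Set.ncard_coe_finset] at this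
    unfold ff
    omega
  have him := ff_image G' γ hγ3
  have hmem : ∀ (X : Finset V) x, x ∈ X → γ x ∈ X.image γ :=
    fun X x hx => Finset.mem_image_of_mem _ hx
  have hmem2 : ∀ (X : Finset V) x, γ (γ x) ∈ X → x ∈ X.image γ := by
    intro X x hx
    have := hmem X _ hx
    rwa [hγ3] at this
  have hk1' : ∀ X : Finset V, γ (γ v₁) ∈ X → γ (γ v₂) ∈ X → 4 ≤ ff G' X := by
    intro X hX hX'
    rw [← him]
    exact hk1 _ (hmem2 _ _ hX) (hmem2 _ _ hX')
  have hk1'' : ∀ X : Finset V, γ v₁ ∈ X → γ v₂ ∈ X → 4 ≤ ff G' X := by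
    intro X hX hX'
    rw [← him]
    exact hk1' _ (hmem _ _ hX) (hmem _ _ hX')
  let T : Finset V := {v₁, v₂, γ v₁, γ v₂, γ (γ v₁), γ (γ v₂)}
  have hT : T.image γ = T := by
    ext x
    simp only [T, Finset.image_insert, Finset.image_singleton, hγ3, Finset.mem_insert,
      Finset.mem_singleton]
    tauto
  have hT4 : ∀ X, T ⊆ X → 4 ≤ ff G' X := fun X hX =>
    hk1 X (hX (by simp [T])) (hX (by simp [T]))
  have hT5 := ff_step G' γ hγ3 hfree T hT 4 (by norm_num) hT4
  have hT6 := ff_step G' γ hγ3 hfree T hT (4 + 1) (by norm_num) hT5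
  have hk2 : ∀ X : Finset V, v₁ ∈ X → v₂ ∈ X → γ v₁ ∈ X → γ v₂ ∈ X → 5 ≤ ff G' X := by
    intro X a b c d
    have h1 := ff_submod G' X (X.image γ)
    rw [him] at h1
    have h2 := hk1'' (X ∩ X.image γ) (Finset.mem_inter.mpr ⟨c, hmem _ _ a⟩)
      (Finset.mem_inter.mpr ⟨d, hmem _ _ b⟩)
    have h3 := hT6 (X ∪ X.image γ) (by
      intro x hx
      simp only [T, Finset.mem_insert, Finset.mem_singleton] at hx
      rw [Finset.mem_union]
      rcases hx with rfl | rfl | rfl | rfl | rfl | rfl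
      · exact Or.inl a
      · exact Or.inl b
      · exact Or.inl c
      · exact Or.inl d
      · exact Or.inr (hmem _ _ c)
      · exact Or.inr (hmem _ _ d))
    omega
  have hk2' : ∀ X : Finset V, v₁ ∈ X → v₂ ∈ X → γ (γ v₁) ∈ X → γ (γ v₂) ∈ X →
      5 ≤ ff G' X := by
    intro X a b c d
    rw [← him]
    exact hk2 _ (hmem2 _ _ c) (hmem2 _ _ d) (hmem _ _ a) (hmem _ _ b)
  have hk2'' : ∀ X : Finset V, γ v₁ ∈ X → γ v₂ ∈ X → γ (γ v₁) ∈ X → γ (γ v₂) ∈ X →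
      5 ≤ ff G' X := by
    intro X a b c d
    rw [← him]
    exact hk2' _ (hmem2 _ _ c) (hmem2 _ _ d) (hmem _ _ a) (hmem _ _ b)
  have hn0 : ¬ G'.Adj v₁ v₂ := by
    intro h
    have h1 := hk1 {v₁, v₂} (by simp) (by simp)
    have h2 : 0 < (indE G' {v₁, v₂}).card := by
      apply Finset.card_pos.mpr
      refine ⟨s(v₁, v₂), ?_⟩
      rw [mem_indE]
      exact ⟨h, by simp⟩
    unfold ff at h1
    rw [Finset.card_pair h12] at h1
    omega
  have hn1 : ¬ G'.Adj (γ v₁) (γ v₂) := by rwa [γ.map_adj_iff]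
  have hn2 : ¬ G'.Adj (γ (γ v₁)) (γ (γ v₂)) := by rwa [γ.map_adj_iff]
  have hγ12 : γ v₁ ≠ γ v₂ := fun h => h12 (γ.injective h)
  have hγγ12 : γ (γ v₁) ≠ γ (γ v₂) := fun h => hγ12 (γ.injective h)
  have hfree2 : ∀ u, γ (γ u) ≠ u := fun u h => hfree u (by
    have := hγ3 u
    rwa [h] at this)
  have d01 : e0 ≠ e1 := by
    intro h
    rw [he0, he1, Sym2.eq_iff] at h
    rcases h with h | h
    · exact hfree _ h.1.symm
    · exact hfree2 v₁ (by rw [← h.2]; exact h.1.symm)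
  have d12 : e1 ≠ e2 := by
    intro h
    rw [he1, he2, Sym2.eq_iff] at h
    rcases h with h | h
    · exact hfree _ h.1.symm
    · exact hfree2 (γ v₁) (by rw [← h.2]; exact h.1.symm)
  have d02 : e0 ≠ e2 := by
    intro h
    rw [he0, he2, Sym2.eq_iff] at h
    rcases h with h | h
    · exact hfree2 _ h.1.symm
    · have h5 : γ v₁ = v₂ := by rw [h.1, hγ3]
      exact hfree (γ v₁) (by rw [← h.2, h5])
  have hes : (G' ⊔ SimpleGraph.fromEdgeSet {e0, e1, e2}).edgeSet = G'.edgeSet ∪ {e0, e1, e2} := by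
    rw [SimpleGraph.edgeSet_sup, SimpleGraph.edgeSet_fromEdgeSet]
    congr 1
    rw [sdiff_eq_left, Set.disjoint_left]
    rintro e (rfl | rfl | rfl)
    · simpa [he0] using h12
    · simpa [he1] using h12
    · simpa [he2] using h12
  refine ⟨?_, ?_⟩
  · rw [hes, Set.ncard_union_eq ?_ (Set.toFinite _) (Set.toFinite _)]
    · have : ({e0, e1, e2} : Set (Sym2 V)).ncard = 3 := Set.ncard_eq_three.mpr
        ⟨e0, e1, e2, d01, d02, d12, rfl⟩
      rw [this]
      push_cast
      omega
    · rw [Set.disjoint_right]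
      rintro e (rfl | rfl | rfl)
      · exact hn0
      · exact hn1
      · exact hn2
  · intro H hH
    classical
    let X : Finset V := H.verts.toFinset
    have hX : H.verts.ncard = X.card := Set.ncard_eq_toFinset_card' _
    let A (e : Sym2 V) : Finset (Sym2 V) := if ∀ v ∈ e, v ∈ X then {e} else ∅
    have hsubs : H.edgeSet ⊆ ((indE G' X ∪ (A e0 ∪ (A e1 ∪ A e2)) : Finset (Sym2 V)) : Set (Sym2 V)) := by
      intro e he
      have h1 : e ∈ G'.edgeSet ∪ {e0, e1, e2} := hes ▸ H.edgeSet_subset he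
      have h2 : ∀ v ∈ e, v ∈ X := fun v hv => by
        simpa [X] using H.mem_verts_of_mem_edge he hv
      have h3 : e ∈ A e := by simp only [A]; rw [if_pos h2]; simp
      simp only [Finset.coe_union, Set.mem_union, Finset.mem_coe]
      rcases h1 with h1 | rfl | rfl | rfl
      · exact Or.inl ((mem_indE _ _ _).mpr ⟨h1, h2⟩)
      · exact Or.inr (Or.inl h3)
      · exact Or.inr (Or.inr (Or.inl h3))
      · exact Or.inr (Or.inr (Or.inr h3))
    have hle := Set.ncard_le_ncard hsubs (Set.toFinite _)
    rw [Set.ncard_coe_finset] at hle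
    have u1 := Finset.card_union_le (indE G' X) (A e0 ∪ (A e1 ∪ A e2))
    have u2 := Finset.card_union_le (A e0) (A e1 ∪ A e2)
    have u3 := Finset.card_union_le (A e1) (A e2)
    have hA : ∀ a b : V, (A s(a, b)).card = 0 ∨ ((A s(a, b)).card = 1 ∧ a ∈ X ∧ b ∈ X) := by
      intro a b
      by_cases h : ∀ v ∈ s(a, b), v ∈ X
      · right
        refine ⟨?_, h a (by simp), h b (by simp)⟩
        simp only [A]; rw [if_pos h]; simp
      · left
        simp only [A]; rw [if_neg h]; simp
    rw [hX] at hH ⊢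
    have fd : ff G' X = 2 * (X.card : ℤ) - ((indE G' X).card : ℤ) := rfl
    rcases hA v₁ v₂ with a0 | ⟨a0, p0, q0⟩ <;>
    rcases hA (γ v₁) (γ v₂) with a1 | ⟨a1, p1, q1⟩ <;>
    rcases hA (γ (γ v₁)) (γ (γ v₂)) with a2 | ⟨a2, p2, q2⟩ <;>
    rw [← he0] at a0 <;> rw [← he1] at a1 <;> rw [← he2] at a2
    · have := hk0 X hH
      omega
    · have := hk1' X p2 q2
      omega
    · have := hk1'' X p1 q1
      omega
    · have := hk2'' X p1 q1 p2 q2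
      omega
    · have := hk1 X p0 q0
      omega
    · have := hk2' X p0 q0 p2 q2
      omega
    · have := hk2 X p0 q0 p1 q1
      omega
    · have := hT6 X (by
        intro x hx
        simp only [T, Finset.mem_insert, Finset.mem_singleton] at hx
        rcases hx with rfl | rfl | rfl | rfl | rfl | rfl <;> assumption)
      omega

end C3Laman
end
end

section
/- Let G be a finite simple graph satisfying the Laman conditions and let γ be an automorphism of G with γ³ = id. Then every (C₃,γ) edge split of G satisfies the Laman conditions. -/
open Matrix

noncomputable section

namespace C3Laman

variable {V : Type*} [Fintype V] [DecidableEq V]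

/-- A `(C₃, γ)` edge split of `G` on distinct base vertices `v₁, v₂, v₃` (where
`{v₁, v₂} ∈ E(G)`), realized on the vertex type `V ⊕ Fin 3` with the three new
vertices `Sum.inr 0, Sum.inr 1, Sum.inr 2`:  the edges `{v₁,v₂}`, `{γv₁,γv₂}`,
`{γ²v₁,γ²v₂}` are deleted and the nine edges from the new vertices are added. -/
def edgeSplitGraph (G : SimpleGraph V) (γ : G ≃g G) (v₁ v₂ v₃ : V) :
    SimpleGraph (V ⊕ Fin 3) :=
  SimpleGraph.fromEdgeSet
    (Sym2.map Sum.inl ''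
        (G.edgeSet \ {s(v₁, v₂), s(γ v₁, γ v₂), s(γ (γ v₁), γ (γ v₂))}) ∪
      {s((Sum.inr 0 : V ⊕ Fin 3), Sum.inl v₁), s((Sum.inr 0 : V ⊕ Fin 3), Sum.inl v₂),
       s((Sum.inr 0 : V ⊕ Fin 3), Sum.inl v₃),
       s((Sum.inr 1 : V ⊕ Fin 3), Sum.inl (γ v₁)),
       s((Sum.inr 1 : V ⊕ Fin 3), Sum.inl (γ v₂)),
       s((Sum.inr 1 : V ⊕ Fin 3), Sum.inl (γ v₃)),
       s((Sum.inr 2 : V ⊕ Fin 3), Sum.inl (γ (γ v₁))),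
       s((Sum.inr 2 : V ⊕ Fin 3), Sum.inl (γ (γ v₂))),
       s((Sum.inr 2 : V ⊕ Fin 3), Sum.inl (γ (γ v₃)))})

section helpers
open Classical

theorem split_general {V : Type*} [Fintype V] [DecidableEq V]
    (G : SimpleGraph V) (hL : Laman G) (w : Fin 3 → Fin 3 → V)
    (hw : ∀ i, Function.Injective (w i))
    (he : Function.Injective (fun i => s(w i 0, w i 1)))
    (hadj : ∀ i, G.Adj (w i 0) (w i 1))
    (K : SimpleGraph (V ⊕ Fin 3))
    (hK : K.edgeSet = Sym2.map Sum.inl '' (G.edgeSet \ Set.range (fun i => s(w i 0, w i 1))) ∪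
      Set.range (fun p : Fin 3 × Fin 3 => s((Sum.inr p.1 : V ⊕ Fin 3), Sum.inl (w p.1 p.2)))) :
    Laman K := by
  obtain ⟨hL1, hL2⟩ := hL
  have hinj : Function.Injective (Sym2.map (Sum.inl : V → V ⊕ Fin 3)) :=
    Sym2.map.injective Sum.inl_injective
  have hp : Function.Injective
      (fun p : Fin 3 × Fin 3 => s((Sum.inr p.1 : V ⊕ Fin 3), Sum.inl (w p.1 p.2))) := by
    rintro ⟨i, j⟩ ⟨i', j'⟩ h
    simp only [Sym2.eq_iff, Sum.inr.injEq, Sum.inl.injEq, reduceCtorEq, and_self, or_false] at h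
    obtain ⟨rfl, h⟩ := h
    rw [hw _ h]
  constructor
  · rw [hK, Set.ncard_union_eq ?_ (Set.toFinite _) (Set.toFinite _),
      Set.ncard_image_of_injective _ hinj]
    · have h1 : (Set.range (fun i => s(w i 0, w i 1))).ncard = 3 := by
        rw [← Set.image_univ, Set.ncard_image_of_injective _ he]; simp [Set.ncard_univ]
      have h2 : (Set.range (fun p : Fin 3 × Fin 3 =>
          s((Sum.inr p.1 : V ⊕ Fin 3), Sum.inl (w p.1 p.2)))).ncard = 9 := by
        rw [← Set.image_univ, Set.ncard_image_of_injective _ hp]; simp [Set.ncard_univ]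
      have h3 := Set.ncard_sdiff_add_ncard_of_subset
        (s := Set.range (fun i => s(w i 0, w i 1))) (t := G.edgeSet) (by
          rintro _ ⟨i, rfl⟩; exact hadj i) (Set.toFinite _)
      rw [h2]
      simp only [Fintype.card_sum, Fintype.card_fin]
      push_cast
      omega
    · rw [Set.disjoint_left]
      rintro _ ⟨x, _, rfl⟩ ⟨p, hp⟩
      induction x with | _ a b => simp at hp
  · intro H hH
    set S : Set V := Sum.inl ⁻¹' H.verts with hS
    set T : Set (Fin 3) := Sum.inr ⁻¹' H.verts with hT
    have hverts : H.verts.ncard = S.ncard + T.ncard := by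
      have : H.verts = Sum.inl '' S ∪ Sum.inr '' T := by
        ext x; cases x <;> simp [hS, hT]
      rw [this, Set.ncard_union_eq ?_ (Set.toFinite _) (Set.toFinite _),
        Set.ncard_image_of_injective _ Sum.inl_injective,
        Set.ncard_image_of_injective _ Sum.inr_injective]
      rw [Set.disjoint_left]
      rintro _ ⟨x, _, rfl⟩ ⟨p, _, hp⟩
      simp at hp
    rw [hverts] at hH ⊢
    set e : Fin 3 → Sym2 V := fun i => s(w i 0, w i 1) with hedef
    set GS : Set (Sym2 V) := ((⊤ : G.Subgraph).induce S).edgeSet with hGS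
    set D : Set (Fin 3) := {i | w i 0 ∈ S ∧ w i 1 ∈ S} with hD
    set P : Set (Fin 3 × Fin 3) := {p | p.1 ∈ T ∧ w p.1 p.2 ∈ S} with hP
    have hFD : (GS \ e '' D).ncard + D.ncard = GS.ncard := by
      rw [← Set.ncard_image_of_injective D he]
      apply Set.ncard_sdiff_add_ncard_of_subset _ (Set.toFinite _)
      rintro _ ⟨i, hi, rfl⟩
      simp only [hGS, hedef, SimpleGraph.Subgraph.mem_edgeSet, SimpleGraph.Subgraph.induce_adj,
        SimpleGraph.Subgraph.top_adj]
      exact ⟨hi.1, hi.2, hadj i⟩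
    have hsub : H.edgeSet ⊆ Sym2.map Sum.inl '' (GS \ e '' D) ∪
        (fun p : Fin 3 × Fin 3 => s((Sum.inr p.1 : V ⊕ Fin 3), Sum.inl (w p.1 p.2))) '' P := by
      intro x hx
      have hxK := H.edgeSet_subset hx
      rw [hK] at hxK
      rcases hxK with ⟨y, ⟨hy1, hy2⟩, rfl⟩ | ⟨p, rfl⟩
      · left
        refine ⟨y, ⟨?_, fun ⟨i, _, hi⟩ => hy2 ⟨i, hi⟩⟩, rfl⟩
        induction y with | _ a b =>
        rw [Sym2.map_mk] at hx
        have hx' : H.Adj (Sum.inl a) (Sum.inl b) := hx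
        simp only [hGS, SimpleGraph.Subgraph.mem_edgeSet, SimpleGraph.Subgraph.induce_adj,
          SimpleGraph.Subgraph.top_adj]
        exact ⟨hx'.fst_mem, hx'.snd_mem, hy1⟩
      · right
        have hx' : H.Adj (Sum.inr p.1) (Sum.inl (w p.1 p.2)) := hx
        exact ⟨p, ⟨hx'.fst_mem, hx'.snd_mem⟩, rfl⟩
    have hcard : H.edgeSet.ncard ≤ (GS \ e '' D).ncard + P.ncard := by
      refine (Set.ncard_le_ncard hsub (Set.toFinite _)).trans ((Set.ncard_union_le _ _).trans ?_)
      rw [Set.ncard_image_of_injective _ hinj, Set.ncard_image_of_injective _ hp]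
    have hPc : P.ncard = ∑ i, ∑ j, if i ∈ T ∧ w i j ∈ S then 1 else 0 := by
      rw [← Fintype.sum_prod_type' (f := fun i j => if i ∈ T ∧ w i j ∈ S then 1 else 0),
        ← Finset.card_filter, ← Set.ncard_coe_finset]
      congr 1
      ext p; simp [hP]
    have hcnt : ∀ A : Set (Fin 3), A.ncard = ∑ i, if i ∈ A then 1 else 0 := by
      intro A
      rw [← Finset.card_filter, ← Set.ncard_coe_finset]
      congr 1
      ext p; simp
    have hverts' : ((⊤ : G.Subgraph).induce S).verts = S := rfl
    rcases Nat.lt_or_ge S.ncard 2 with hlt | hge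
    · have hGS0 : GS = ∅ := by
        rw [Set.eq_empty_iff_forall_notMem]
        intro y hy
        induction y with | _ a b =>
        simp only [hGS, SimpleGraph.Subgraph.mem_edgeSet, SimpleGraph.Subgraph.induce_adj,
          SimpleGraph.Subgraph.top_adj] at hy
        have := (Set.ncard_le_one (Set.toFinite S)).1 (by omega) a hy.1 b hy.2.1
        exact hy.2.2.ne this
      have hP1 : P.ncard ≤ S.ncard * T.ncard := by
        rw [hcnt T, hPc, Finset.mul_sum]
        apply Finset.sum_le_sum
        intro i _
        by_cases hi : i ∈ T
        · simp only [hi, true_and, if_true, mul_one]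
          rw [← Finset.card_filter, ← Finset.card_image_of_injective _ (hw i),
            ← Set.ncard_coe_finset]
          apply Set.ncard_le_ncard _ (Set.toFinite _)
          intro x hx
          simp at hx
          obtain ⟨j, hj, rfl⟩ := hx
          exact hj
        · simp [hi]
      have hGS0' : GS.ncard = 0 := by rw [hGS0]; simp
      interval_cases S.ncard <;> omega
    · have h := hL2 ((⊤ : G.Subgraph).induce S) hge
      rw [hverts'] at h
      have hP2 : P.ncard ≤ 2 * T.ncard + D.ncard := by
        rw [hcnt T, hcnt D, hPc, Finset.mul_sum, ← Finset.sum_add_distrib]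
        apply Finset.sum_le_sum
        intro i _
        rw [Fin.sum_univ_three]
        by_cases hi : i ∈ T <;> by_cases h0 : w i 0 ∈ S <;> by_cases h1 : w i 1 ∈ S <;>
          by_cases h2 : w i 2 ∈ S <;> simp [hi, h0, h1, h2, hD]
      change (GS.ncard : ℤ) ≤ _ at h
      push_cast
      omega

end helpers

/-- If `G` satisfies the Laman conditions and `γ` is an automorphism of `G` with
`γ³ = id`, then every `(C₃, γ)` edge split of `G` satisfies the Laman conditions. -/
theorem c3_edge_split_laman {V : Type*} [Fintype V] [DecidableEq V]
    (G : SimpleGraph V) (γ : G ≃g G) (hγ3 : ∀ v, γ (γ (γ v)) = v)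
    (hlaman : Laman G) (v₁ v₂ v₃ : V)
    (h12 : v₁ ≠ v₂) (h23 : v₂ ≠ v₃) (h13 : v₁ ≠ v₃)
    (hadj : G.Adj v₁ v₂) (hnotfix : ¬(γ v₁ = v₁ ∧ γ v₂ = v₂)) :
    Laman (edgeSplitGraph G γ v₁ v₂ v₃) := by
  have h3 : γ v₁ = v₁ ∧ γ v₂ = v₂ ∨ γ v₁ = v₂ ∧ γ v₂ = v₁ → False := by
    rintro (h | ⟨h1, h2⟩)
    · exact hnotfix h
    · have := hγ3 v₁
      rw [h1, h2, h1] at this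
      exact h12 this.symm
  have hi := γ.injective
  have hadj1 : G.Adj (γ v₁) (γ v₂) := γ.map_adj_iff.2 hadj
  have hadj2 : G.Adj (γ (γ v₁)) (γ (γ v₂)) := γ.map_adj_iff.2 hadj1
  have e01 : s(γ v₁, γ v₂) ≠ s(v₁, v₂) := by
    intro h; exact h3 (by simpa [Sym2.eq_iff] using h)
  have e12 : s(γ (γ v₁), γ (γ v₂)) ≠ s(γ v₁, γ v₂) := by
    intro h; exact h3 (by simpa [Sym2.eq_iff, hi.eq_iff] using h)
  have e02 : s(γ (γ v₁), γ (γ v₂)) ≠ s(v₁, v₂) := by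
    intro h
    have h' := congrArg (Sym2.map γ) h
    simp only [Sym2.map_mk, hγ3] at h'
    exact e01 h'.symm
  apply split_general G hlaman
    ![![v₁, v₂, v₃], ![γ v₁, γ v₂, γ v₃], ![γ (γ v₁), γ (γ v₂), γ (γ v₃)]]
  · intro i a b hab
    fin_cases i <;> fin_cases a <;> fin_cases b <;>
      first | rfl | (exfalso; revert hab; simp [hi.eq_iff, h12, h13, h23, h12.symm, h13.symm, h23.symm])
  · intro a b hab
    fin_cases a <;> fin_cases b <;> first | rfl | exact absurd hab e01 | exact absurd hab e02 | exact absurd hab e12 | exact absurd hab.symm e01 | exact absurd hab.symm e02 | exact absurd hab.symm e12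
  · intro i
    fin_cases i
    exacts [hadj, hadj1, hadj2]
  · rw [edgeSplitGraph, SimpleGraph.edgeSet_fromEdgeSet]
    have hr : (Set.range fun i : Fin 3 => s((![![v₁, v₂, v₃], ![γ v₁, γ v₂, γ v₃], ![γ (γ v₁), γ (γ v₂), γ (γ v₃)]] : Fin 3 → Fin 3 → V) i 0, (![![v₁, v₂, v₃], ![γ v₁, γ v₂, γ v₃], ![γ (γ v₁), γ (γ v₂), γ (γ v₃)]] : Fin 3 → Fin 3 → V) i 1)) = {s(v₁, v₂), s(γ v₁, γ v₂), s(γ (γ v₁), γ (γ v₂))} := by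
      ext x
      simp [Fin.exists_fin_succ, eq_comm]
    rw [hr, sdiff_eq_left.2]
    · congr 1
      ext x
      simp [Prod.exists, Fin.exists_fin_succ, eq_comm, or_assoc]
    · rw [Set.disjoint_left]
      rintro _ (⟨y, ⟨hy, _⟩, rfl⟩ | h)
      · induction y with | _ a b =>
        have : a ≠ b := G.ne_of_adj hy
        simpa using this
      · simp only [Set.mem_insert_iff, Set.mem_singleton_iff] at h
        rcases h with h|h|h|h|h|h|h|h|h <;> subst h <;> simp

end C3Laman
end
end
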